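/- Let σ̃ > 0, c̃ > 0, ĉ > 0 and m > 0 be real. Define R : (σ̃, ∞) → ℝ by R(f₀) := ((1/ĉ)·log(c̃/(f₀ − σ̃)))^{1/m} for σ̃ < f₀ ≤ σ̃ + c̃ and R(f₀) := 0 for f₀ > σ̃ + c̃ (so R is continuous, nonnegative, and compactly supported). Then for every f ∈ (σ̃, σ̃ + c̃) the quantity Φ(f) := −(1/π)·√f·(d/df) ∫_f^∞ R(f₀)/√(f₀² − f²) df₀ is well defined, and the improper integral ∫_{σ̃}^{σ̃ + c̃/2} Φ(f) df converges. -/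

import Mathlib

open MeasureTheory

/-- The potential data for exponentially fast approach to linear confinement:
`R f₀ = ((1/k)·log(c/(f₀ − σ)))^(1/m)` for `σ < f₀ ≤ σ + c` and `R f₀ = 0` for
`f₀ > σ + c`. -/
noncomputable def R18 (σ c k m : ℝ) (f₀ : ℝ) : ℝ :=
  if f₀ ≤ σ + c then (1 / k * Real.log (c / (f₀ - σ))) ^ (1 / m : ℝ) else 0

/-- `G18 σ c k m f = ∫_f^∞ R18 σ c k m f₀ / √(f₀² − f²) df₀`. -/
noncomputable def G18 (σ c k m : ℝ) (f : ℝ) : ℝ :=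
  ∫ f₀ in Set.Ioi f, R18 σ c k m f₀ / Real.sqrt (f₀ ^ 2 - f ^ 2)

/-- `Φ18 σ c k m f = −(1/π)·√f·(d/df) G18 σ c k m f`. -/
noncomputable def Φ18 (σ c k m : ℝ) (f : ℝ) : ℝ :=
  -(1 / Real.pi) * Real.sqrt f * deriv (G18 σ c k m) f

open Set

/-- The branch of `R18` on `(σ, σ + c]`. -/
noncomputable def separation (σ c k m x : ℝ) : ℝ :=
  (1 / k * Real.log (c / (x - σ))) ^ (1 / m : ℝ)

/-- The affine parametrization of `[f, σ + c]` by `t ∈ [0, 1]`. -/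
noncomputable def segPoint (σ c f t : ℝ) : ℝ := f + (σ + c - f) * t

/-- The integrand of `G18` transported to `t ∈ (0, 1)` by `segPoint`. -/
noncomputable def segIntegrand (σ c k m f t : ℝ) : ℝ :=
  Real.sqrt ((σ + c - f) / (t * (f + segPoint σ c f t))) * separation σ c k m (segPoint σ c f t)

/-- The logarithmic derivative of `segIntegrand` with respect to `f`. -/
noncomputable def segLogDeriv (σ c m f t : ℝ) : ℝ :=
  -((1 - t) / (m * (Real.log (c / (segPoint σ c f t - σ)) * (segPoint σ c f t - σ)))) -
    1 / (2 * (σ + c - f)) - (2 - t) / (2 * (f + segPoint σ c f t))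

section

variable {σ c k m f f₁ t x : ℝ}

lemma segPoint_lt (hf : f < σ + c) (ht : t < 1) : segPoint σ c f t < σ + c := by
  unfold segPoint; nlinarith

lemma le_segPoint (hf : f < σ + c) (ht : 0 < t) : f ≤ segPoint σ c f t := by
  unfold segPoint; nlinarith [mul_pos (sub_pos.2 hf) ht]

lemma mul_le_segPoint_sub (hσf : σ < f) (hf : f ≤ f₁) (ht : 0 < t) :
    (σ + c - f₁) * t ≤ segPoint σ c f t - σ := by
  unfold segPoint; nlinarith

lemma log_div_sub_pos (hx : σ < x) (hx' : x < σ + c) : 0 < Real.log (c / (x - σ)) :=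
  Real.log_pos ((one_lt_div (by linarith)).2 (by linarith))

lemma separation_nonneg (hk : 0 < k) (hx : σ < x) (hx' : x < σ + c) :
    0 ≤ separation σ c k m x :=
  Real.rpow_nonneg (mul_nonneg (by positivity) (log_div_sub_pos hx hx').le) _

lemma separation_le (hk : 0 < k) (hm : 0 < m) (hx : σ < x) (hx' : x < σ + c) :
    separation σ c k m x ≤
      (4 / (k * m)) ^ (1 / m) * c ^ (1 / 4 : ℝ) * (x - σ) ^ (-(1 / 4) : ℝ) := by
  have hy : 0 < x - σ := by linarith
  have hc : 0 < c := by linarith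
  have hlog := Real.log_le_rpow_div (x := c / (x - σ)) (by positivity)
    (show (0 : ℝ) < m / 4 by positivity)
  have hpos := log_div_sub_pos hx hx'
  calc separation σ c k m x
      ≤ (4 / (k * m) * (c / (x - σ)) ^ (m / 4)) ^ (1 / m) := by
        refine Real.rpow_le_rpow (by positivity) ?_ (by positivity)
        calc 1 / k * Real.log (c / (x - σ)) ≤ 1 / k * ((c / (x - σ)) ^ (m / 4) / (m / 4)) := by
              gcongr
          _ = _ := by field_simp
    _ = _ := by
        rw [Real.mul_rpow (by positivity) (by positivity), ← Real.rpow_mul (by positivity),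
          Real.div_rpow hc.le hy.le, Real.rpow_neg hy.le]
        have : m / 4 * (1 / m) = 1 / 4 := by field_simp
        rw [this]
        ring

lemma hasDerivAt_separation (hk : 0 < k) (hm : 0 < m) (hx : σ < x) (hx' : x < σ + c) :
    HasDerivAt (separation σ c k m)
      (separation σ c k m x * -(1 / (m * (Real.log (c / (x - σ)) * (x - σ))))) x := by
  have hy : 0 < x - σ := by linarith
  have hc : 0 < c := by linarith
  have hpos := log_div_sub_pos hx hx'
  have h1 : HasDerivAt (fun x => c / (x - σ)) (-c / (x - σ) ^ 2) x := by
    refine ((hasDerivAt_const x c).div ((hasDerivAt_id x).sub_const σ) hy.ne').congr_deriv ?_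
    simp
  have h2 := ((h1.log (by positivity)).const_mul (1 / k)).rpow_const (p := 1 / m)
    (Or.inl (by positivity))
  refine h2.congr_deriv ?_
  rw [Real.rpow_sub_one (by positivity), separation]
  field_simp

lemma hasDerivAt_segIntegrand (hσ : 0 < σ) (hk : 0 < k) (hm : 0 < m)
    (hσf : σ < f) (hf : f < σ + c) (ht : t ∈ Ioo (0 : ℝ) 1) :
    HasDerivAt (fun f => segIntegrand σ c k m f t)
      (segIntegrand σ c k m f t * segLogDeriv σ c m f t) f := by
  have hx' := segPoint_lt hf ht.2
  have hx := le_segPoint hf ht.1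
  have h0 := ht.1
  have hb : 0 < σ + c - f := by linarith
  have hs : 0 < f + segPoint σ c f t := by linarith
  have hseg : HasDerivAt (fun f => segPoint σ c f t) (1 - t) f := by
    refine ((hasDerivAt_id f).add (((hasDerivAt_id f).const_sub (σ + c)).mul_const t)).congr_deriv ?_
    ring
  have hsep := (hasDerivAt_separation hk hm (lt_of_lt_of_le hσf hx) hx').comp f hseg
  have hq := ((hasDerivAt_id f).const_sub (σ + c)).div
    (((hasDerivAt_id f).add hseg).const_mul t) (by simpa using ⟨h0.ne', hs.ne'⟩)
  have hqpos : 0 < (σ + c - f) / (t * (f + segPoint σ c f t)) := by positivity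
  refine ((hq.sqrt hqpos.ne').mul hsep).congr_deriv ?_
  simp only [segIntegrand, segLogDeriv, Function.comp, Pi.add_apply, Pi.div_apply, id]
  set q := (σ + c - f) / (t * (f + segPoint σ c f t)) with hqdef
  have hsq : 0 < Real.sqrt q := Real.sqrt_pos.2 hqpos
  have hq' : (-1 * (t * (f + segPoint σ c f t)) - (σ + c - f) * (t * (1 + (1 - t)))) /
      (t * (f + segPoint σ c f t)) ^ 2 =
      Real.sqrt q ^ 2 * (-(1 / (σ + c - f)) - (2 - t) / (f + segPoint σ c f t)) := by
    rw [Real.sq_sqrt hqpos.le, hqdef]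
    field_simp
    ring
  rw [hq']
  field_simp
  ring

lemma abs_segLogDeriv_le (hσ : 0 < σ) (hm : 0 < m)
    (hσf : σ < f) (hf : f ≤ f₁) (hf₁ : f₁ < σ + c) (ht : t ∈ Ioo (0 : ℝ) 1) :
    |segLogDeriv σ c m f t| ≤
      (c / (m * (σ + c - f₁)) + c / (2 * (σ + c - f₁)) + c / (2 * σ)) /
        (segPoint σ c f t - σ) := by
  have hfc : f < σ + c := by linarith
  have hc : 0 < c := by linarith
  have hx' := segPoint_lt hfc ht.2
  have hx := le_segPoint hfc ht.1
  have h0 := ht.1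
  have h1 := ht.2
  set x := segPoint σ c f t with hxdef
  have hb : 0 < σ + c - f₁ := by linarith
  have hy : 0 < x - σ := by linarith
  have hlog : (c - (x - σ)) / c ≤ Real.log (c / (x - σ)) := by
    refine le_trans (le_of_eq ?_) (Real.one_sub_inv_le_log_of_pos (by positivity))
    field_simp
  have hpos := log_div_sub_pos (lt_of_lt_of_le hσf hx) hx'
  have hdiff : c - (x - σ) = (σ + c - f) * (1 - t) := by rw [hxdef, segPoint]; ring
  have hA : (1 - t) / (m * (Real.log (c / (x - σ)) * (x - σ))) ≤
      c / (m * (σ + c - f₁)) / (x - σ) := by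
    rw [div_div, div_le_div_iff₀ (by positivity) (by positivity)]
    have h2 : (σ + c - f₁) * (1 - t) ≤ c * Real.log (c / (x - σ)) := by
      rw [div_le_iff₀ hc, hdiff] at hlog
      nlinarith
    have := mul_le_mul_of_nonneg_left h2 (mul_pos hm hy).le
    linarith
  have hB : 1 / (2 * (σ + c - f)) ≤ c / (2 * (σ + c - f₁)) / (x - σ) := by
    rw [div_div, div_le_div_iff₀ (by linarith) (by positivity)]
    nlinarith [mul_le_mul (show σ + c - f₁ ≤ σ + c - f by linarith)
      (show x - σ ≤ c by linarith) hy.le (by linarith)]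
  have hC : (2 - t) / (2 * (f + x)) ≤ c / (2 * σ) / (x - σ) := by
    rw [div_div, div_le_div_iff₀ (by linarith) (by positivity)]
    have : (2 - t) * (σ * (x - σ)) ≤ 2 * (σ * c) := by
      apply mul_le_mul (by linarith) (by gcongr; linarith) (by positivity) (by norm_num)
    nlinarith [mul_pos hc hσ]
  have hA0 : 0 ≤ (1 - t) / (m * (Real.log (c / (x - σ)) * (x - σ))) :=
    div_nonneg (by linarith) (by positivity)
  have hB0 : 0 ≤ 1 / (2 * (σ + c - f)) := div_nonneg zero_le_one (by linarith)
  have hC0 : 0 ≤ (2 - t) / (2 * (f + x)) := div_nonneg (by linarith) (by linarith)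
  rw [add_div, add_div, segLogDeriv, ← hxdef, abs_le]
  constructor <;> linarith

lemma abs_segIntegrand_le (hσ : 0 < σ) (hk : 0 < k) (hm : 0 < m)
    (hσf : σ < f) (hf : f < σ + c) (ht : t ∈ Ioo (0 : ℝ) 1) :
    |segIntegrand σ c k m f t| ≤
      Real.sqrt (c / (2 * σ)) * ((4 / (k * m)) ^ (1 / m) * c ^ (1 / 4 : ℝ)) *
        (t ^ (-(1 / 2) : ℝ) * (segPoint σ c f t - σ) ^ (-(1 / 4) : ℝ)) := by
  have hc : 0 < c := by linarith
  have hx' := segPoint_lt hf ht.2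
  have hx := lt_of_lt_of_le hσf (le_segPoint hf ht.1)
  have h0 := ht.1
  have hsqrt : Real.sqrt ((σ + c - f) / (t * (f + segPoint σ c f t))) ≤
      Real.sqrt (c / (2 * σ)) * t ^ (-(1 / 2) : ℝ) := by
    rw [Real.rpow_neg h0.le, ← Real.sqrt_eq_rpow, ← Real.sqrt_inv, ← Real.sqrt_mul (by positivity)]
    apply Real.sqrt_le_sqrt
    rw [← div_eq_mul_inv, div_div]
    apply div_le_div₀ hc.le (by linarith) (by positivity)
    nlinarith
  rw [segIntegrand, abs_of_nonneg (mul_nonneg (Real.sqrt_nonneg _) (separation_nonneg hk hx hx'))]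
  refine (mul_le_mul hsqrt (separation_le hk hm hx hx') (separation_nonneg hk hx hx')
    (by positivity)).trans (le_of_eq ?_)
  ring

lemma exists_abs_deriv_segIntegrand_le (hσ : 0 < σ) (hk : 0 < k) (hm : 0 < m)
    (hσf₁ : σ < f₁) (hf₁ : f₁ < σ + c) :
    ∃ C, 0 ≤ C ∧ ∀ f ∈ Ioc σ f₁, ∀ t ∈ Ioo (0 : ℝ) 1,
      |segIntegrand σ c k m f t * segLogDeriv σ c m f t| ≤
        C * (f - σ) ^ (-(7 / 8) : ℝ) * t ^ (-(7 / 8) : ℝ) := by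
  have hc : 0 < c := by linarith
  have hb : 0 < σ + c - f₁ := by linarith
  set A := Real.sqrt (c / (2 * σ)) * ((4 / (k * m)) ^ (1 / m) * c ^ (1 / 4 : ℝ)) with hA
  set B := c / (m * (σ + c - f₁)) + c / (2 * (σ + c - f₁)) + c / (2 * σ) with hB
  have hA0 : 0 ≤ A := by positivity
  have hB0 : 0 ≤ B := by positivity
  refine ⟨A * B * (σ + c - f₁) ^ (-(3 / 8) : ℝ), by positivity, fun f hf t ht => ?_⟩
  have hfc : f < σ + c := hf.2.trans_lt hf₁
  have h0 := ht.1
  have hd : 0 < f - σ := sub_pos.2 hf.1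
  have hx := le_segPoint hfc h0
  have hy : 0 < segPoint σ c f t - σ := by linarith
  have hI := abs_segIntegrand_le hσ hk hm hf.1 hfc ht
  have hL := abs_segLogDeriv_le hσ hm hf.1 hf.2 hf₁ ht
  rw [← hA] at hI
  rw [← hB] at hL
  have h1 : (segPoint σ c f t - σ) ^ (-(7 / 8) : ℝ) ≤ (f - σ) ^ (-(7 / 8) : ℝ) :=
    Real.rpow_le_rpow_of_nonpos hd (by linarith) (by norm_num)
  have h2 : (segPoint σ c f t - σ) ^ (-(3 / 8) : ℝ) ≤ ((σ + c - f₁) * t) ^ (-(3 / 8) : ℝ) :=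
    Real.rpow_le_rpow_of_nonpos (by positivity) (mul_le_segPoint_sub hf.1 hf.2 h0) (by norm_num)
  have hsplit : (segPoint σ c f t - σ) ^ (-(1 / 4) : ℝ) / (segPoint σ c f t - σ) =
      (segPoint σ c f t - σ) ^ (-(7 / 8) : ℝ) * (segPoint σ c f t - σ) ^ (-(3 / 8) : ℝ) := by
    rw [← Real.rpow_add hy, ← Real.rpow_sub_one hy.ne']
    norm_num
  have ht2 : t ^ (-(1 / 2) : ℝ) * t ^ (-(3 / 8) : ℝ) = t ^ (-(7 / 8) : ℝ) := by
    rw [← Real.rpow_add h0]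
    norm_num
  rw [abs_mul]
  calc _ ≤ A * (t ^ (-(1 / 2) : ℝ) * (segPoint σ c f t - σ) ^ (-(1 / 4) : ℝ)) *
        (B / (segPoint σ c f t - σ)) := mul_le_mul hI hL (abs_nonneg _) (by positivity)
    _ = A * B * t ^ (-(1 / 2) : ℝ) *
        ((segPoint σ c f t - σ) ^ (-(1 / 4) : ℝ) / (segPoint σ c f t - σ)) := by ring
    _ ≤ A * B * t ^ (-(1 / 2) : ℝ) *
        ((f - σ) ^ (-(7 / 8) : ℝ) * ((σ + c - f₁) * t) ^ (-(3 / 8) : ℝ)) := by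
      rw [hsplit]
      gcongr
    _ = _ := by
      rw [Real.mul_rpow hb.le h0.le, ← ht2]
      ring

lemma integrableOn_rpow_neg {s b : ℝ} (hs : -1 < s) (hb : 0 < b) :
    IntegrableOn (fun t : ℝ => t ^ s) (Ioo 0 b) :=
  (intervalIntegral.integrableOn_Ioo_rpow_iff hb).2 hs

lemma measurable_segIntegrand : Measurable (segIntegrand σ c k m f) := by
  unfold segIntegrand separation segPoint
  fun_prop

lemma measurable_segLogDeriv : Measurable (segLogDeriv σ c m f) := by
  unfold segLogDeriv segPoint
  fun_prop

lemma integrableOn_segIntegrand (hσ : 0 < σ) (hk : 0 < k) (hm : 0 < m)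
    (hσf : σ < f) (hf : f < σ + c) :
    IntegrableOn (segIntegrand σ c k m f) (Ioo 0 1) := by
  have hc : 0 < c := by linarith
  refine Integrable.mono' (((integrableOn_rpow_neg (s := -(1 / 2)) (by norm_num)
    one_pos).mul_const ((f - σ) ^ (-(1 / 4) : ℝ))).const_mul
    (Real.sqrt (c / (2 * σ)) * ((4 / (k * m)) ^ (1 / m) * c ^ (1 / 4 : ℝ))))
    measurable_segIntegrand.aestronglyMeasurable ?_
  refine (ae_restrict_iff' measurableSet_Ioo).2 (.of_forall fun t ht => ?_)
  refine (abs_segIntegrand_le hσ hk hm hσf hf ht).trans ?_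
  have h0 := ht.1
  have := Real.rpow_le_rpow_of_nonpos (z := -(1 / 4)) (sub_pos.2 hσf)
    (sub_le_sub_right (le_segPoint hf h0) σ) (by norm_num)
  gcongr

lemma G18_eq (hσ : 0 < σ) (hσf : σ < f) (hf : f < σ + c) :
    G18 σ c k m f = ∫ t in Ioo (0 : ℝ) 1, segIntegrand σ c k m f t := by
  have hb : 0 < σ + c - f := by linarith
  calc G18 σ c k m f
      = ∫ x in Ioc f (σ + c), R18 σ c k m x / Real.sqrt (x ^ 2 - f ^ 2) := by
        refine setIntegral_eq_of_subset_of_forall_sdiff_eq_zero measurableSet_Ioi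
          Ioc_subset_Ioi_self fun x hx => ?_
        have : ¬ x ≤ σ + c := fun h => hx.2 ⟨hx.1, h⟩
        simp [R18, this]
    _ = ∫ x in f..(σ + c), R18 σ c k m x / Real.sqrt (x ^ 2 - f ^ 2) :=
        (intervalIntegral.integral_of_le hf.le).symm
    _ = (σ + c - f) * ∫ t in (0 : ℝ)..1, R18 σ c k m (f + (σ + c - f) * t) /
          Real.sqrt ((f + (σ + c - f) * t) ^ 2 - f ^ 2) := by
        have := intervalIntegral.smul_integral_comp_add_mul (a := 0) (b := 1)
          (fun x => R18 σ c k m x / Real.sqrt (x ^ 2 - f ^ 2)) (σ + c - f) f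
        rw [smul_eq_mul] at this
        rw [this]
        simp
    _ = _ := by
        rw [intervalIntegral.integral_of_le zero_le_one, integral_Ioc_eq_integral_Ioo,
          ← integral_const_mul]
        refine setIntegral_congr_fun measurableSet_Ioo fun t ht => ?_
        have h0 := ht.1
        have hx' := segPoint_lt hf ht.2
        have hx := le_segPoint hf h0
        have hs : 0 < t * (f + segPoint σ c f t) := mul_pos h0 (by linarith)
        have hx2 : segPoint σ c f t ^ 2 - f ^ 2 =
            (σ + c - f) * (t * (f + segPoint σ c f t)) := by
          unfold segPoint
          ring
        change (σ + c - f) * (R18 σ c k m (segPoint σ c f t) /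
          Real.sqrt (segPoint σ c f t ^ 2 - f ^ 2)) = _
        rw [hx2, R18, if_pos hx'.le, segIntegrand, separation, Real.sqrt_mul hb.le,
          Real.sqrt_div hb.le]
        have hsb := Real.sqrt_pos.2 hb
        have hss := Real.sqrt_pos.2 hs
        field_simp
        rw [Real.sq_sqrt hb.le]
        ring

lemma hasDerivAt_G18 (hσ : 0 < σ) (hk : 0 < k) (hm : 0 < m)
    (hσf : σ < f) (hf : f < σ + c) :
    HasDerivAt (G18 σ c k m)
      (∫ t in Ioo (0 : ℝ) 1, segIntegrand σ c k m f t * segLogDeriv σ c m f t) f := by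
  obtain ⟨f₁, hff₁, hf₁⟩ := exists_between hf
  obtain ⟨f₀, hf₀, hf₀f⟩ := exists_between hσf
  obtain ⟨C, hC, hbound⟩ := exists_abs_deriv_segIntegrand_le hσ hk hm (hσf.trans hff₁) hf₁
  have hnhds : Ioo f₀ f₁ ∈ nhds f := Ioo_mem_nhds hf₀f hff₁
  have key := (hasDerivAt_integral_of_dominated_loc_of_deriv_le
    (μ := volume.restrict (Ioo (0 : ℝ) 1))
    (F := segIntegrand σ c k m)
    (F' := fun f t => segIntegrand σ c k m f t * segLogDeriv σ c m f t)
    (bound := fun t => C * (f₀ - σ) ^ (-(7 / 8) : ℝ) * t ^ (-(7 / 8) : ℝ)) hnhds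
    (.of_forall fun _ => measurable_segIntegrand.aestronglyMeasurable)
    (integrableOn_segIntegrand hσ hk hm hσf hf)
    (measurable_segIntegrand.mul measurable_segLogDeriv).aestronglyMeasurable
    ((ae_restrict_iff' measurableSet_Ioo).2 (.of_forall fun t ht g hg => ?_))
    ((integrableOn_rpow_neg (by norm_num) one_pos).const_mul _)
    ((ae_restrict_iff' measurableSet_Ioo).2 (.of_forall fun t ht g hg =>
      hasDerivAt_segIntegrand hσ hk hm (hf₀.trans hg.1) (hg.2.trans hf₁) ht))).2
  · refine key.congr_of_eventuallyEq ?_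
    filter_upwards [hnhds] with g hg
    exact G18_eq hσ (hf₀.trans hg.1) (hg.2.trans hf₁)
  · refine (hbound g ⟨hf₀.trans hg.1, hg.2.le⟩ t ht).trans ?_
    have h0 := ht.1
    have := Real.rpow_le_rpow_of_nonpos (z := -(7 / 8)) (sub_pos.2 hf₀)
      (sub_le_sub_right hg.1.le σ) (by norm_num)
    gcongr

lemma exists_abs_deriv_G18_le (hσ : 0 < σ) (hk : 0 < k) (hm : 0 < m)
    (hσf₁ : σ < f₁) (hf₁ : f₁ < σ + c) :
    ∃ C, 0 ≤ C ∧ ∀ f ∈ Ioc σ f₁, |deriv (G18 σ c k m) f| ≤ C * (f - σ) ^ (-(7 / 8) : ℝ) := by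
  obtain ⟨C, hC, hbound⟩ := exists_abs_deriv_segIntegrand_le hσ hk hm hσf₁ hf₁
  have hint := integrableOn_rpow_neg (s := -(7 / 8)) (by norm_num) one_pos
  refine ⟨C * ∫ t in Ioo (0 : ℝ) 1, t ^ (-(7 / 8) : ℝ), mul_nonneg hC
    (setIntegral_nonneg measurableSet_Ioo fun t ht => Real.rpow_nonneg ht.1.le _),
    fun f hf => ?_⟩
  rw [(hasDerivAt_G18 hσ hk hm hf.1 (hf.2.trans_lt hf₁)).deriv]
  calc |∫ t in Ioo (0 : ℝ) 1, segIntegrand σ c k m f t * segLogDeriv σ c m f t|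
      ≤ ∫ t in Ioo (0 : ℝ) 1, C * (f - σ) ^ (-(7 / 8) : ℝ) * t ^ (-(7 / 8) : ℝ) :=
        (Real.norm_eq_abs _).symm.le.trans <| norm_integral_le_of_norm_le (hint.const_mul _)
          ((ae_restrict_iff' measurableSet_Ioo).2 (.of_forall fun t ht => hbound f hf t ht))
    _ = _ := by
      rw [integral_const_mul]
      ring

lemma integrableOn_Φ18 (hσ : 0 < σ) (hk : 0 < k) (hm : 0 < m)
    (hσf₁ : σ < f₁) (hf₁ : f₁ < σ + c) :
    IntegrableOn (Φ18 σ c k m) (Ioo σ f₁) := by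
  obtain ⟨C, hC, hbound⟩ := exists_abs_deriv_G18_le hσ hk hm hσf₁ hf₁
  have hint : IntegrableOn (fun f : ℝ => (f - σ) ^ (-(7 / 8) : ℝ)) (Ioo σ f₁) := by
    have h := (intervalIntegral.intervalIntegrable_rpow' (a := 0) (b := f₁ - σ)
      (r := -(7 / 8)) (by norm_num)).comp_sub_right σ
    rw [zero_add, sub_add_cancel, intervalIntegrable_iff_integrableOn_Ioo_of_le hσf₁.le] at h
    exact h
  have hmeas : Measurable (Φ18 σ c k m) := by
    have := measurable_deriv (G18 σ c k m)
    unfold Φ18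
    fun_prop
  refine Integrable.mono' (hint.const_mul (1 / Real.pi * Real.sqrt f₁ * C))
    hmeas.aestronglyMeasurable
    ((ae_restrict_iff' measurableSet_Ioo).2 (.of_forall fun f hf => ?_))
  rw [Φ18, Real.norm_eq_abs, abs_mul, abs_mul, abs_neg, abs_of_pos (by positivity),
    abs_of_nonneg (Real.sqrt_nonneg f), mul_assoc _ C]
  gcongr
  · exact hf.2.le
  · exact hbound f ⟨hf.1, hf.2.le⟩

end

/-- Exponentially fast approach to linear confinement puts the IR bottom at finite radial
coordinate: for the data `R18`, the quantity
`Φ f = −(1/π)·√f·(d/df)∫_f^∞ R(f₀)/√(f₀² − f²) df₀` is well defined on `(σ̃, σ̃ + c̃)` and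
the improper integral `∫_{σ̃}^{σ̃ + c̃/2} Φ(f) df` converges. -/
theorem stmt_18 (σ c k m : ℝ) (hσ : 0 < σ) (hc : 0 < c) (hk : 0 < k) (hm : 0 < m) :
    (∀ f ∈ Set.Ioo σ (σ + c), DifferentiableAt ℝ (G18 σ c k m) f) ∧
    IntegrableOn (Φ18 σ c k m) (Set.Ioo σ (σ + c / 2)) := by
  exact ⟨fun f hf => (hasDerivAt_G18 hσ hk hm hf.1 hf.2).differentiableAt,
    integrableOn_Φ18 hσ hk hm (by linarith) (by linarith)⟩
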